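/- Let μ be a shift-invariant probability measure on A^ℕ satisfying hypothesis (A) with constants c, h, and let f be the run-length encoder. For k ∈ ℕ, let Z_k = {ω ∈ B^k : |f^{-1}ω| ≤ k³} be the set of cylinders of length k in B^ℕ whose preimage under f is a cylinder of length at most k³. Then every ω ∈ B^k with ω ∉ Z_k satisfies μ(f^{-1}ω) ≤ c·e^{−h k²}, and consequently Σ_{ω∈B^k, ω∉Z_k} μ(f^{-1}ω)² ≤ c·e^{−h k²}. -/

import Mathlib

open MeasureTheory Filter Topology

section RLEDefs

variable {A : Type*}

/-- The starting position of the run following the run that starts at position `i`: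
the least index `> i` where the value of `x` changes (with the junk convention `i + 1`
if the sequence is constant from position `i` on). -/
noncomputable def nextChange (x : ℕ → A) (i : ℕ) : ℕ := by
  classical
  exact if h : ∃ j, x (i + j + 1) ≠ x i then i + Nat.find h + 1 else i + 1

/-- Starting position of the `n`-th maximal run of the sequence `x`. -/
noncomputable def runStart (x : ℕ → A) : ℕ → ℕ
  | 0 => 0
  | n + 1 => nextChange x (runStart x n)

/-- The run-length encoder `f : A^ℕ → (A × ℕ)^ℕ`: the `n`-th symbol of `f x` is the pair
(value of the `n`-th maximal run of `x`, length of that run). -/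
noncomputable def rle (x : ℕ → A) (n : ℕ) : A × ℕ :=
  (x (runStart x n), runStart x (n + 1) - runStart x n)

/-- `M_n(u,v)`: the length of the longest common substring of `u` and `v`
occurring within their first `n` symbols, i.e.
`max {k : u_i^{i+k-1} = v_j^{j+k-1} for some 0 ≤ i,j ≤ n-k}`. -/
noncomputable def matchLen {C : Type*} (u v : ℕ → C) (n : ℕ) : ℕ :=
  sSup {k | ∃ i j, i + k ≤ n ∧ j + k ≤ n ∧ ∀ m < k, u (i + m) = v (j + m)}

/-- `M^RLE_n(x,y) = M_n(f x, f y)`. -/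
noncomputable def MRLE (x y : ℕ → A) (n : ℕ) : ℕ := matchLen (rle x) (rle y) n

/-- `M̃_n(x,y) = max {k : f(σ^i x)_1^k = f(σ^j y)_1^k for some 0 ≤ i,j ≤ n-k}`. -/
noncomputable def Mtilde (x y : ℕ → A) (n : ℕ) : ℕ :=
  sSup {k | ∃ i j, i + k ≤ n ∧ j + k ≤ n ∧
    ∀ m < k, rle (fun t => x (t + i)) m = rle (fun t => y (t + j)) m}

/-- The number of maximal runs in the first `n` symbols of `x`, i.e. `|f(x_1^n)|`. -/
noncomputable def runCount (x : ℕ → A) (n : ℕ) : ℕ := by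
  classical
  exact ((Finset.range n).filter fun i => i = 0 ∨ x i ≠ x (i - 1)).card

/-- The left shift `σ` on sequences. -/
def shift (x : ℕ → A) : ℕ → A := fun n => x (n + 1)

variable [MeasurableSpace A]

/-- `Σ_{ω ∈ B^n} (f_*μ)(ω)²`: the sum, over all cylinders `ω` of length `n` in
`B^ℕ = (A × ℕ)^ℕ`, of the squared measure of `f⁻¹ω` (where `f` is the run-length
encoder), i.e. of the squared pushforward measure of the cylinder. -/
noncomputable def pushCylSum (μ : Measure (ℕ → A)) (n : ℕ) : ℝ :=
  ∑' ω : Fin n → A × ℕ, ((μ {x | ∀ i : Fin n, rle x i = ω i}).toReal) ^ 2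

/-- Lower Rényi entropy of order 2 of the pushforward measure `f_*μ`:
`H̲₂(f_*μ) = - liminf_n (1/n) log Σ_ω (f_*μ)(ω)²`. -/
noncomputable def H2lower (μ : Measure (ℕ → A)) : ℝ :=
  -liminf (fun n : ℕ => Real.log (pushCylSum μ n) / n) atTop

/-- Upper Rényi entropy of order 2 of the pushforward measure `f_*μ`:
`H̄₂(f_*μ) = - limsup_n (1/n) log Σ_ω (f_*μ)(ω)²`. -/
noncomputable def H2upper (μ : Measure (ℕ → A)) : ℝ :=
  -limsup (fun n : ℕ => Real.log (pushCylSum μ n) / n) atTop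

/-- Hypothesis (A): there are `c > 0`, `h > 0` with `μ(a…a) ≤ c e^{-hn}` for every
constant cylinder `a…a` of length `n`. -/
def HypA (μ : Measure (ℕ → A)) (c h : ℝ) : Prop :=
  0 < c ∧ 0 < h ∧
    ∀ (n : ℕ) (a : A), μ {x | ∀ i < n, x i = a} ≤ ENNReal.ofReal (c * Real.exp (-h * n))

/-- The σ-algebra `F_0^n` generated by the coordinates `X_0, …, X_n`. -/
def cylAlgLE (A : Type*) [MeasurableSpace A] (n : ℕ) : MeasurableSpace (ℕ → A) :=
  MeasurableSpace.comap (fun x (i : Fin (n + 1)) => x i) inferInstance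

/-- The σ-algebra `F_m^∞` generated by the coordinates `X_m, X_{m+1}, …`. -/
def cylAlgGE (A : Type*) [MeasurableSpace A] (m : ℕ) : MeasurableSpace (ℕ → A) :=
  MeasurableSpace.comap (fun x (i : ℕ) => x (m + i)) inferInstance

/-- α-mixing with rate function `a`: for all `n, g` and all `S ∈ F_0^n`, `T ∈ F_{n+g}^∞`,
`|μ(S ∩ T) - μ(S)μ(T)| ≤ a(g)`. -/
def AlphaMixingBound (μ : Measure (ℕ → A)) (a : ℕ → ℝ) : Prop :=
  ∀ (n g : ℕ) (S T : Set (ℕ → A)),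
    MeasurableSet[cylAlgLE A n] S → MeasurableSet[cylAlgGE A (n + g)] T →
    |(μ (S ∩ T)).toReal - (μ S).toReal * (μ T).toReal| ≤ a g

/-- α-mixing with exponential decay. -/
def AlphaMixingExp (μ : Measure (ℕ → A)) : Prop :=
  ∃ C θ : ℝ, 0 < C ∧ 0 < θ ∧ AlphaMixingBound μ fun g => C * Real.exp (-θ * g)

/-- ψ-mixing with polynomial rate `ψ(g) = g^{-a}`: for all `n` and `g ≥ 1` and all
`S ∈ F_0^n`, `T ∈ F_{n+g}^∞`, `|μ(S ∩ T) - μ(S)μ(T)| ≤ g^{-a} μ(S) μ(T)`. -/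
def PsiMixingPoly (μ : Measure (ℕ → A)) (a : ℝ) : Prop :=
  ∀ (n g : ℕ), 1 ≤ g → ∀ (S T : Set (ℕ → A)),
    MeasurableSet[cylAlgLE A n] S → MeasurableSet[cylAlgGE A (n + g)] T →
    |(μ (S ∩ T)).toReal - (μ S).toReal * (μ T).toReal| ≤
      (g : ℝ) ^ (-a) * (μ S).toReal * (μ T).toReal

/-- `S_n = Σ_{0 ≤ i,j ≤ n-1} 1_{A_{i,j}}` with `A_{i,j} = {f(σ^i X)_1^k = f(σ^j Y)_1^k}`,
seen as a random variable on the product space (X = first coordinate, Y = second). -/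
noncomputable def Sn (k n : ℕ) (p : (ℕ → A) × (ℕ → A)) : ℝ := by
  classical
  exact ∑ i ∈ Finset.range n, ∑ j ∈ Finset.range n,
    if ∀ m < k, rle (fun t => p.1 (t + i)) m = rle (fun t => p.2 (t + j)) m then (1 : ℝ) else 0

end RLEDefs


theorem nextChange_spec {A : Type*} (x : ℕ → A) (i m : ℕ) :
    nextChange x i = m ↔
      ((i < m ∧ (∀ t, i ≤ t → t < m → x t = x i) ∧ x m ≠ x i) ∨
        (m = i + 1 ∧ ∀ t, x (i + t + 1) = x i)) := by
  classical
  unfold nextChange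
  split_ifs with h
  · constructor
    · rintro rfl
      refine Or.inl ⟨by omega, ?_, Nat.find_spec h⟩
      intro t h1 h2
      rcases Nat.eq_or_lt_of_le h1 with h3 | h3
      · rw [h3]
      · have := Nat.find_min h (m := t - i - 1) (by omega)
        rw [not_not] at this
        rwa [show i + (t - i - 1) + 1 = t by omega] at this
    · rintro (⟨h1, h2, h3⟩ | ⟨_, h2⟩)
      · have : Nat.find h = m - i - 1 := by
          rw [Nat.find_eq_iff]
          refine ⟨by rwa [show i + (m - i - 1) + 1 = m by omega], ?_⟩
          intro n hn
          rw [not_not]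
          exact h2 _ (by omega) (by omega)
        omega
      · obtain ⟨j, hj⟩ := h
        exact absurd (h2 j) hj
  · push Not at h
    constructor
    · rintro rfl
      exact Or.inr ⟨rfl, h⟩
    · rintro (⟨h1, h2, h3⟩ | ⟨h1, _⟩)
      · have := h (m - i - 1)
        rw [show i + (m - i - 1) + 1 = m by omega] at this
        exact absurd this h3
      · exact h1.symm

theorem nextChange_const {A : Type*} (x : ℕ → A) (i : ℕ) :
    i < nextChange x i ∧ ∀ t, i ≤ t → t < nextChange x i → x t = x i := by
  rcases (nextChange_spec x i _).1 rfl with ⟨h1, h2, _⟩ | ⟨h1, h2⟩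
  · exact ⟨h1, h2⟩
  · refine ⟨by omega, fun t ht ht2 => ?_⟩
    rw [show t = i by omega]

theorem measurable_nextChange {A : Type*} [Fintype A] [MeasurableSpace A]
    [MeasurableSingletonClass A] (i : ℕ) :
    Measurable (fun x : ℕ → A => nextChange x i) := by
  have hE : ∀ a b : ℕ, MeasurableSet {x : ℕ → A | x a = x b} := fun a b =>
    measurableSet_eq_fun (measurable_pi_apply a) (measurable_pi_apply b)
  refine measurable_to_countable' fun m => ?_
  have : (fun x : ℕ → A => nextChange x i) ⁻¹' {m} =
      {x | (i < m ∧ (∀ t, i ≤ t → t < m → x t = x i) ∧ ¬ x m = x i) ∨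
        (m = i + 1 ∧ ∀ t, x (i + t + 1) = x i)} := by
    ext x
    exact nextChange_spec x i m
  rw [this]
  have hE' : ∀ a b : ℕ, Measurable (fun x : ℕ → A => x a = x b) := fun a b =>
    measurableSet_setOf.1 (hE a b)
  refine measurableSet_setOf.2 (Measurable.or (Measurable.and measurable_const
    (Measurable.and ?_ (hE' _ _).not)) (Measurable.and measurable_const ?_))
  · exact Measurable.forall fun t => Measurable.imp measurable_const
      (Measurable.imp measurable_const (hE' _ _))
  · exact Measurable.forall fun t => hE' _ _

theorem measurable_runStart {A : Type*} [Fintype A] [MeasurableSpace A]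
    [MeasurableSingletonClass A] (n : ℕ) :
    Measurable (fun x : ℕ → A => runStart x n) := by
  induction n with
  | zero => exact measurable_const
  | succ n ih =>
    have h : Measurable (fun p : (ℕ → A) × ℕ => nextChange p.1 p.2) :=
      measurable_from_prod_countable_left fun i => measurable_nextChange i
    exact h.comp (measurable_id.prodMk ih)

theorem measurable_rle {A : Type*} [Fintype A] [MeasurableSpace A]
    [MeasurableSingletonClass A] (n : ℕ) :
    Measurable (fun x : ℕ → A => rle x n) := by
  have h : Measurable (fun p : (ℕ → A) × ℕ => p.1 p.2) :=
    measurable_from_prod_countable_left fun i => measurable_pi_apply i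
  exact (h.comp (measurable_id.prodMk (measurable_runStart n))).prodMk
    ((measurable_runStart (n + 1)).sub (measurable_runStart n))

theorem runStart_eq_sum {A : Type*} (x : ℕ → A) (n : ℕ) :
    runStart x n = ∑ j ∈ Finset.range n, (rle x j).2 := by
  induction n with
  | zero => rfl
  | succ n ih =>
    rw [Finset.sum_range_succ, ← ih]
    have := (nextChange_const x (runStart x n)).1
    simp only [rle, runStart]
    omega

theorem rle_cyl_bound {A : Type*} [Fintype A] [MeasurableSpace A] [MeasurableSingletonClass A]
    (μ : Measure (ℕ → A)) [IsProbabilityMeasure μ]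
    (hinv : MeasurePreserving (shift (A := A)) μ μ)
    (c h : ℝ) (hA : HypA μ c h) (k : ℕ) (ω : Fin k → A × ℕ)
    (hω : k ^ 3 < (∑ i : Fin k, (ω i).2) + 1) :
    μ {x | ∀ i : Fin k, rle x i = ω i} ≤ ENNReal.ofReal (c * Real.exp (-h * (k : ℝ) ^ 2)) := by
  rcases Nat.eq_zero_or_pos k with rfl | hk
  · obtain ⟨x⟩ : Nonempty (ℕ → A) := nonempty_of_isProbabilityMeasure μ
    have := hA.2.2 0 (x 0)
    simpa using this
  · obtain ⟨i, hi⟩ : ∃ i : Fin k, k ^ 2 ≤ (ω i).2 := by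
      by_contra! hcon
      have : ∑ i : Fin k, (ω i).2 < ∑ i : Fin k, k ^ 2 :=
        Finset.sum_lt_sum_of_nonempty ⟨⟨0, hk⟩, Finset.mem_univ _⟩ fun i _ => hcon i
      simp only [Finset.sum_const, Finset.card_univ, Fintype.card_fin, smul_eq_mul] at this
      have e : k * k ^ 2 = k ^ 3 := by ring
      omega
    set s : ℕ := ∑ j : Fin i.1, (ω ⟨j.1, j.2.trans i.2⟩).2 with hs
    have hiter : ∀ (s : ℕ) (x : ℕ → A) (t : ℕ), (shift^[s]) x t = x (t + s) := by
      intro s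
      induction s with
      | zero => intro x t; rfl
      | succ s ih =>
        intro x t
        rw [Function.iterate_succ_apply, ih]
        rfl
    have hsub : {x | ∀ i : Fin k, rle x i = ω i} ⊆
        (shift^[s]) ⁻¹' {x : ℕ → A | ∀ t < k ^ 2, x t = (ω i).1} := by
      intro x hx t ht
      have hx' : ∀ i : Fin k, rle x i = ω i := hx
      have hrs : runStart x i.1 = s := by
        rw [runStart_eq_sum, Finset.sum_range, hs]
        exact Finset.sum_congr rfl fun j _ => by
          rw [← hx' ⟨j.1, j.2.trans i.2⟩]
      have h1 := congrArg Prod.fst (hx' i)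
      have h2 := congrArg Prod.snd (hx' i)
      simp only [rle, runStart, hrs] at h1 h2
      rw [hiter, ← h1]
      exact (nextChange_const x s).2 _ (by omega) (by omega)
    have hm : MeasurableSet {x : ℕ → A | ∀ t < k ^ 2, x t = (ω i).1} :=
      measurableSet_setOf.2 (Measurable.forall fun t => Measurable.imp measurable_const
        (measurableSet_setOf.1 (measurableSet_eq_fun (measurable_pi_apply t) measurable_const)))
    calc _ ≤ _ := measure_mono hsub
      _ = _ := (hinv.iterate s).measure_preimage hm.nullMeasurableSet
      _ ≤ _ := hA.2.2 (k ^ 2) (ω i).1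
      _ = _ := by push_cast; rfl

/-- for a cylinder `ω` of length `k` in `B^ℕ`, the preimage `f⁻¹ω` is the
cylinder of `A^ℕ` of length `|f⁻¹ω| = (Σ_{i<k} (ω i).2) + 1` (the sum of the declared run
lengths plus one terminating symbol).  If `ω ∉ Z_k`, i.e. `|f⁻¹ω| > k³`, then
`μ(f⁻¹ω) ≤ c e^{-hk²}`, and consequently `Σ_{ω ∉ Z_k} μ(f⁻¹ω)² ≤ c e^{-hk²}`. -/
theorem stmt10 {A : Type*} [Fintype A] [MeasurableSpace A] [MeasurableSingletonClass A]
    (μ : Measure (ℕ → A)) [IsProbabilityMeasure μ]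
    (hinv : MeasurePreserving (shift (A := A)) μ μ)
    (c h : ℝ) (hA : HypA μ c h) (k : ℕ) :
    (∀ ω : Fin k → A × ℕ, k ^ 3 < (∑ i : Fin k, (ω i).2) + 1 →
        μ {x | ∀ i : Fin k, rle x i = ω i} ≤
          ENNReal.ofReal (c * Real.exp (-h * (k : ℝ) ^ 2))) ∧
    ∑' ω : {ω : Fin k → A × ℕ // k ^ 3 < (∑ i : Fin k, (ω i).2) + 1},
        ((μ {x | ∀ i : Fin k, rle x i = ω.1 i}).toReal) ^ 2 ≤
      c * Real.exp (-h * (k : ℝ) ^ 2) := by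
  refine ⟨fun ω hω => rle_cyl_bound μ hinv c h hA k ω hω, ?_⟩
  have hM : 0 ≤ c * Real.exp (-h * (k : ℝ) ^ 2) := mul_nonneg hA.1.le (Real.exp_pos _).le
  refine Real.tsum_le_of_sum_le (fun ω => sq_nonneg _) fun F => ?_
  have hmeas : ∀ ω : {ω : Fin k → A × ℕ // k ^ 3 < (∑ i : Fin k, (ω i).2) + 1},
      MeasurableSet {x : ℕ → A | ∀ i : Fin k, rle x i = ω.1 i} := fun ω =>
    measurableSet_setOf.2 (Measurable.forall fun i => measurableSet_setOf.1
      (measurable_rle i.1 (measurableSet_singleton (ω.1 i))))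
  have hsum : ∑ ω ∈ F, (μ {x | ∀ i : Fin k, rle x i = ω.1 i}).toReal ≤ 1 := by
    have h1 := measureReal_biUnion_finset (μ := μ) (s := F)
      (f := fun ω => {x : ℕ → A | ∀ i : Fin k, rle x i = ω.1 i}) (by
        intro ω _ ω' _ hne
        refine Set.disjoint_left.2 fun x hx hx' => hne (Subtype.ext (funext fun i => ?_))
        exact (hx i).symm.trans (hx' i)) (fun ω _ => hmeas ω)
    have h2 : μ.real (⋃ ω ∈ F, {x : ℕ → A | ∀ i : Fin k, rle x i = ω.1 i}) ≤ 1 :=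
      measureReal_le_one
    rw [h1] at h2
    exact h2
  calc ∑ ω ∈ F, ((μ {x | ∀ i : Fin k, rle x i = ω.1 i}).toReal) ^ 2
      ≤ ∑ ω ∈ F, c * Real.exp (-h * (k : ℝ) ^ 2) *
          (μ {x | ∀ i : Fin k, rle x i = ω.1 i}).toReal := by
        refine Finset.sum_le_sum fun ω _ => ?_
        rw [sq]
        exact mul_le_mul_of_nonneg_right
          (ENNReal.toReal_le_of_le_ofReal hM (rle_cyl_bound μ hinv c h hA k ω.1 ω.2))
          ENNReal.toReal_nonneg
    _ = c * Real.exp (-h * (k : ℝ) ^ 2) *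
          ∑ ω ∈ F, (μ {x | ∀ i : Fin k, rle x i = ω.1 i}).toReal := by
        rw [Finset.mul_sum]
    _ ≤ c * Real.exp (-h * (k : ℝ) ^ 2) := mul_le_of_le_one_right hM hsum
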